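/- arXiv:2306.06695 — 2 statements merged into one kernel-verified Lean document; each statement's English description precedes it below -/
import Mathlib

section
/- For the once-punctured convex m-gon P*_m (m ≥ 2), there is an enumeration T_1, …, T_N of all triangulations of P*_m such that for all indices 1 ≤ j < k ≤ N there exists i < k with |T_i ∩ T_k| = m−2 and T_j ∩ T_k ⊆ T_i ∩ T_k. (The arc complex of a once-punctured polygon is shellable.) -/
/-!
Vertices of the once-punctured convex `m`-gon `P*_m` are identified with `ZMod m`.
An arc is an equivalence class `[(a,b)]` of pairs of integers with
`a < b ≤ a + m` and `b - a ≥ 2`, modulo `(a,b) ∼ (a+m, b+m)`.  Each class has a unique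
representative with `0 ≤ a < m`; we identify arcs with these canonical representatives,
i.e. with pairs `p : ℤ × ℤ` satisfying `IsPArc m p` below.
Blue is encoded by the Boolean value `true`, red by `false`.
-/

namespace Punc

/-- `p` is (the canonical representative of) an arc of `P*_m`:
`0 ≤ p.1 < m`, `p.1 < p.2 ≤ p.1 + m` and `p.2 - p.1 ≥ 2`. -/
def IsPArc (m : ℕ) (p : ℤ × ℤ) : Prop :=
  0 ≤ p.1 ∧ p.1 < (m : ℤ) ∧ p.1 + 2 ≤ p.2 ∧ p.2 ≤ p.1 + (m : ℤ)

/-- The arcs `[(a,b)] = p` and `[(c,d)] = q` cross: there is an integer `k` with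
`a + km < c < b + km < d` or with `c < a + km < d < b + km`. -/
def PCross (m : ℕ) (p q : ℤ × ℤ) : Prop :=
  ∃ k : ℤ, (p.1 + k * m < q.1 ∧ q.1 < p.2 + k * m ∧ p.2 + k * m < q.2) ∨
    (q.1 < p.1 + k * m ∧ p.1 + k * m < q.2 ∧ q.2 < p.2 + k * m)

/-- The arc `p` is the maximal arc based at `p.1 mod m`, i.e. `p.2 - p.1 = m`. -/
def IsMaximalArc (m : ℕ) (p : ℤ × ℤ) : Prop :=
  IsPArc m p ∧ p.2 - p.1 = (m : ℤ)

/-- A triangulation of `P*_m`: a set of `m - 1` pairwise non-crossing arcs. -/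
def IsPTriangulation (m : ℕ) (T : Finset (ℤ × ℤ)) : Prop :=
  T.card = m - 1 ∧ (∀ p ∈ T, IsPArc m p) ∧
    ∀ p ∈ T, ∀ q ∈ T, p ≠ q → ¬ PCross m p q

/-- A bicolouring: a function from the vertices to {red, blue} attaining both values
(`true` = blue, `false` = red). -/
def IsBicolouring (m : ℕ) (c : ZMod m → Bool) : Prop :=
  (∃ v, c v = true) ∧ (∃ v, c v = false)

/-- A bicolouring is non-trivial if some arc has both endpoints red. -/
def IsNontrivialBicolouring (m : ℕ) (c : ZMod m → Bool) : Prop :=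
  IsBicolouring m c ∧
    ∃ p : ℤ × ℤ, IsPArc m p ∧ c (p.1 : ZMod m) = false ∧ c (p.2 : ZMod m) = false

/-- An arc is permitted if at least one of its endpoints is blue. -/
def Permitted (m : ℕ) (c : ZMod m → Bool) (p : ℤ × ℤ) : Prop :=
  c (p.1 : ZMod m) = true ∨ c (p.2 : ZMod m) = true

/-- A permissible triangulation: a triangulation all of whose arcs are permitted. -/
def IsPermissible (m : ℕ) (c : ZMod m → Bool) (T : Finset (ℤ × ℤ)) : Prop :=
  IsPTriangulation m T ∧ ∀ p ∈ T, Permitted m c p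

/-- Two permissible triangulations are joined in the flip graph of permissible
triangulations: there is a finite sequence of permissible triangulations from one to the
other in which consecutive triangulations share exactly `m - 2` arcs. -/
def PermFlipJoined (m : ℕ) (c : ZMod m → Bool) (T₁ T₂ : Finset (ℤ × ℤ)) : Prop :=
  ∃ n : ℕ, ∃ f : Fin (n + 1) → Finset (ℤ × ℤ),
    f 0 = T₁ ∧ f (Fin.last n) = T₂ ∧ (∀ i, IsPermissible m c (f i)) ∧
    ∀ i : Fin n, (f i.castSucc ∩ f i.succ).card = m - 2

/-- Sorting by a potential gives a shelling order as soon as, for any two distinct facets, one of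
them can be replaced by an adjacent facet of smaller potential that still contains their
intersection. -/
theorem exists_shelling_of_potential {α β : Type*} [DecidableEq α] [LinearOrder β]
    (C : Finset (Finset α)) (n : ℕ) (Φ : Finset α → β)
    (h : ∀ S ∈ C, ∀ T ∈ C, S ≠ T →
      (∃ U ∈ C, Φ U < Φ S ∧ (U ∩ S).card = n ∧ S ∩ T ⊆ U) ∨
      (∃ U ∈ C, Φ U < Φ T ∧ (U ∩ T).card = n ∧ T ∩ S ⊆ U)) :
    ∃ N : ℕ, ∃ f : Fin N → Finset α, Function.Injective f ∧ (∀ i, f i ∈ C) ∧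
      (∀ T ∈ C, ∃ i, f i = T) ∧
      ∀ j k : Fin N, j < k → ∃ i : Fin N, i < k ∧ (f i ∩ f k).card = n ∧
        f j ∩ f k ⊆ f i ∩ f k := by
  let g : Fin C.card → Finset α := fun i => (C.equivFin.symm i : Finset α)
  let σ := Tuple.sort (Φ ∘ g)
  have hmono : Monotone ((Φ ∘ g) ∘ σ) := Tuple.monotone_sort (Φ ∘ g)
  have hinj : Function.Injective (g ∘ σ) :=
    (Subtype.val_injective.comp C.equivFin.symm.injective).comp σ.injective
  have hmem : ∀ i, (g ∘ σ) i ∈ C := fun i => (C.equivFin.symm (σ i)).2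
  have hsurj : ∀ T ∈ C, ∃ i, (g ∘ σ) i = T := fun T hT =>
    ⟨σ.symm (C.equivFin ⟨T, hT⟩), by simp [g]⟩
  have hlt : ∀ i j, Φ ((g ∘ σ) i) < Φ ((g ∘ σ) j) → i < j := fun i j hij =>
    lt_of_not_ge fun hji => absurd (hmono hji) (not_le.mpr hij)
  refine ⟨C.card, g ∘ σ, hinj, hmem, hsurj, ?_⟩
  generalize g ∘ σ = f at *
  intro j
  induction j using WellFoundedLT.induction with
  | ind j ih =>
    intro k hjk
    rcases h _ (hmem j) _ (hmem k) (fun e => hjk.ne (hinj e)) with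
      ⟨U, hU, hΦ, -, hsub⟩ | ⟨U, hU, hΦ, hcard, hsub⟩
    · obtain ⟨j', rfl⟩ := hsurj U hU
      have hj' := hlt _ _ hΦ
      obtain ⟨i, hik, hc, hs⟩ := ih j' hj' k (hj'.trans hjk)
      exact ⟨i, hik, hc, fun x hx =>
        hs (Finset.mem_inter.mpr ⟨hsub hx, (Finset.mem_inter.mp hx).2⟩)⟩
    · obtain ⟨i, rfl⟩ := hsurj U hU
      exact ⟨i, hlt _ _ hΦ, hcard, fun x hx => Finset.mem_inter.mpr
        ⟨hsub (by rwa [Finset.inter_comm]), (Finset.mem_inter.mp hx).2⟩⟩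

/-- A noncrossing family of diagonals and the base edge of a polygon with vertices `l, …, r` has at
most `r - l - 1` elements. -/
theorem card_le_of_noncrossing_polygon (n : ℕ) : ∀ (l r : ℤ), r = l + n + 1 →
    ∀ S : Finset (ℤ × ℤ), (∀ x ∈ S, l ≤ x.1 ∧ x.1 + 2 ≤ x.2 ∧ x.2 ≤ r) →
      (∀ x ∈ S, ∀ y ∈ S, ¬ (x.1 < y.1 ∧ y.1 < x.2 ∧ x.2 < y.2)) → S.card ≤ n := by
  induction n using Nat.strong_induction_on with
  | _ n ih =>
  intro l r hr S hS hcr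
  rcases Nat.eq_zero_or_pos n with rfl | hn
  · have : S = ∅ := by
      by_contra hne
      obtain ⟨x, hx⟩ := Finset.nonempty_iff_ne_empty.mpr hne
      have := hS x hx
      push_cast at hr
      omega
    simp [this]
  obtain ⟨c, ⟨hlc, hcr', hc⟩, hmax⟩ := Int.exists_greatest_of_bdd
    (P := fun c => l < c ∧ c < r ∧ (c = l + 1 ∨ (l, c) ∈ S))
    ⟨r, fun z hz => hz.2.1.le⟩ ⟨l + 1, by omega, by omega, Or.inl rfl⟩
  have hsub : S ⊆ insert (l, r) (S.filter (fun x => x.2 ≤ c) ∪ S.filter (fun x => c ≤ x.1)) := by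
    intro x hx
    have h1 := hS x hx
    simp only [Finset.mem_insert, Finset.mem_union, Finset.mem_filter, hx, true_and]
    by_contra hcon
    push Not at hcon
    obtain ⟨hne, h2, h3⟩ := hcon
    rcases h1.1.eq_or_lt with h4 | h4
    · rcases h1.2.2.eq_or_lt with h5 | h5
      · exact hne (Prod.ext h4.symm h5)
      · have := hmax x.2 ⟨by omega, h5, Or.inr (by rw [h4]; exact hx)⟩
        omega
    · rcases hc with hc | hc
      · omega
      · exact hcr _ hc x hx ⟨h4, h3, h2⟩
  have hL : (S.filter (fun x => x.2 ≤ c)).card ≤ (c - l - 1).toNat := by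
    refine ih _ (by omega) l c (by omega) _ ?_ ?_
    · intro x hx
      rw [Finset.mem_filter] at hx
      exact ⟨(hS x hx.1).1, (hS x hx.1).2.1, hx.2⟩
    · intro x hx y hy
      exact hcr x (Finset.mem_filter.mp hx).1 y (Finset.mem_filter.mp hy).1
  have hR : (S.filter (fun x => c ≤ x.1)).card ≤ (r - c - 1).toNat := by
    refine ih _ (by omega) c r (by omega) _ ?_ ?_
    · intro x hx
      rw [Finset.mem_filter] at hx
      exact ⟨hx.2, (hS x hx.1).2.1, (hS x hx.1).2.2⟩
    · intro x hx y hy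
      exact hcr x (Finset.mem_filter.mp hx).1 y (Finset.mem_filter.mp hy).1
  have h1 := Finset.card_le_card hsub
  have h2 := Finset.card_insert_le (l, r)
    (S.filter (fun x => x.2 ≤ c) ∪ S.filter (fun x => c ≤ x.1))
  have h3 := Finset.card_union_le (S.filter (fun x => x.2 ≤ c)) (S.filter (fun x => c ≤ x.1))
  omega

/-- A set of pairwise noncrossing arcs of `P*_m`. -/
def IsNoncrossing (m : ℕ) (S : Finset (ℤ × ℤ)) : Prop :=
  (∀ p ∈ S, IsPArc m p) ∧ ∀ p ∈ S, ∀ q ∈ S, p ≠ q → ¬ PCross m p q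

/-- `(p, q)` is a translate by a multiple of `m` of an element of `S`. -/
def IsLift (m : ℕ) (S : Finset (ℤ × ℤ)) (p q : ℤ) : Prop :=
  ∃ k : ℤ, (p + k * m, q + k * m) ∈ S

/-- `(p, q)` is a boundary edge or a translate of an element of `S`. -/
def IsSide (m : ℕ) (S : Finset (ℤ × ℤ)) (p q : ℤ) : Prop :=
  q = p + 1 ∨ IsLift m S p q

theorem eq_zero_of_mul_lt {m k : ℤ} (h₁ : -m < k * m) (h₂ : k * m < m) : k = 0 := by
  have hm : 0 < m := by linarith
  have : k < 1 := by nlinarith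
  have : -1 < k := by nlinarith
  omega

theorem isLift_of_mem {m : ℕ} {S : Finset (ℤ × ℤ)} {p q : ℤ} (h : (p, q) ∈ S) :
    IsLift m S p q := ⟨0, by simpa using h⟩

theorem IsLift.add_mul {m : ℕ} {S : Finset (ℤ × ℤ)} {p q : ℤ} (h : IsLift m S p q) (k : ℤ) :
    IsLift m S (p + k * m) (q + k * m) := by
  obtain ⟨j, hj⟩ := h
  refine ⟨j - k, ?_⟩
  convert hj using 2 <;> ring

theorem IsLift.length {m : ℕ} {S : Finset (ℤ × ℤ)} (hS : IsNoncrossing m S) {p q : ℤ}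
    (h : IsLift m S p q) : p + 2 ≤ q ∧ q ≤ p + m := by
  obtain ⟨j, hj⟩ := h
  obtain ⟨-, -, h1, h2⟩ := hS.1 _ hj
  dsimp only at h1 h2
  constructor <;> linarith

theorem IsLift.not_cross {m : ℕ} {S : Finset (ℤ × ℤ)} (hS : IsNoncrossing m S) {p q r s : ℤ}
    (h : IsLift m S p q) (h' : IsLift m S r s) : ¬ (p < r ∧ r < q ∧ q < s) := by
  rintro ⟨h1, h2, h3⟩
  have hl := h.length hS
  obtain ⟨k, hk⟩ := h
  obtain ⟨j, hj⟩ := h'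
  by_cases he : (p + k * (m : ℤ), q + k * (m : ℤ)) = (r + j * (m : ℤ), s + j * (m : ℤ))
  · rw [Prod.mk.injEq] at he
    have e : (k - j) * (m : ℤ) = r - p := by linarith [he.1]
    have := eq_zero_of_mul_lt (m := (m : ℤ)) (k := k - j) (by linarith) (by linarith)
    rw [this] at e
    linarith
  · refine hS.2 _ hk _ hj he ⟨j - k, Or.inl ⟨?_, ?_, ?_⟩⟩ <;> dsimp only <;> linarith

/-- An arc of maximal length of a noncrossing set separates no lift of its left endpoint. -/
theorem exists_lift_endpoint {m : ℕ} {S : Finset (ℤ × ℤ)} (hS : IsNoncrossing m S)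
    (hne : S.Nonempty) :
    ∃ a : ℤ, 0 ≤ a ∧ a < m ∧ ∀ p q, IsLift m S p q → ¬ (p < a ∧ a < q) := by
  obtain ⟨x, hx, hmax⟩ := S.exists_max_image (fun x => x.2 - x.1) hne
  refine ⟨x.1, (hS.1 x hx).1, (hS.1 x hx).2.1, ?_⟩
  rintro p q h ⟨h1, h2⟩
  have h3 := h.not_cross hS (isLift_of_mem (m := m) (p := x.1) (q := x.2) hx)
  obtain ⟨k, hk⟩ := h
  have := hmax _ hk
  dsimp only at this
  omega

theorem IsNoncrossing.card_le {m : ℕ} {S : Finset (ℤ × ℤ)} (hS : IsNoncrossing m S) :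
    S.card ≤ m - 1 := by
  rcases S.eq_empty_or_nonempty with rfl | hne
  · simp
  obtain ⟨a, ha0, ham, ha⟩ := exists_lift_endpoint hS hne
  let φ : ℤ × ℤ → ℤ × ℤ := fun x => if x.1 < a then (x.1 + m, x.2 + m) else x
  have hφ : ∀ x ∈ S, IsLift m S (φ x).1 (φ x).2 ∧ a ≤ (φ x).1 ∧ (φ x).2 ≤ a + m := by
    intro x hx
    obtain ⟨h1, h2, h3, h4⟩ := hS.1 x hx
    have hl : IsLift m S x.1 x.2 := isLift_of_mem hx
    simp only [φ]
    split_ifs with h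
    · have := ha _ _ hl
      exact ⟨by simpa using hl.add_mul 1, by dsimp only; omega, by dsimp only; omega⟩
    · have := ha _ _ (hl.add_mul (-1))
      exact ⟨hl, by omega, by omega⟩
  have hinj : Set.InjOn φ S := by
    intro x hx y hy hxy
    obtain ⟨h1, h2, -, -⟩ := hS.1 x hx
    obtain ⟨h3, h4, -, -⟩ := hS.1 y hy
    simp only [φ] at hxy
    split_ifs at hxy with h5 h6 h6
    · rw [Prod.mk.injEq] at hxy
      exact Prod.ext (by omega) (by omega)
    · rw [← hxy] at h4
      dsimp only at h4
      omega
    · rw [hxy] at h2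
      dsimp only at h2
      omega
    · exact hxy
  rw [← Finset.card_image_of_injOn hinj]
  refine card_le_of_noncrossing_polygon (m - 1) a (a + m) (by omega) _ ?_ ?_
  · simp only [Finset.forall_mem_image]
    intro x hx
    obtain ⟨h1, h2, h3⟩ := hφ x hx
    exact ⟨h2, (h1.length hS).1, h3⟩
  · simp only [Finset.forall_mem_image]
    intro x hx y hy
    exact (hφ x hx).1.not_cross hS (hφ y hy).1

theorem IsPTriangulation.isNoncrossing {m : ℕ} {T : Finset (ℤ × ℤ)} (hT : IsPTriangulation m T) :
    IsNoncrossing m T := hT.2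

theorem exists_canonical {m : ℕ} (hm : 2 ≤ m) {l d : ℤ} (h₁ : l + 2 ≤ d) (h₂ : d ≤ l + m) :
    ∃ j : ℤ, IsPArc m (l + j * m, d + j * m) := by
  have hm0 : (0 : ℤ) < m := by omega
  have e : l + -(l / m) * m = l % m := by
    linarith [Int.emod_add_mul_ediv l m, mul_comm (m : ℤ) (l / m)]
  refine ⟨-(l / m), ?_, ?_, ?_, ?_⟩ <;> dsimp only
  · rw [e]
    exact Int.emod_nonneg _ hm0.ne'
  · rw [e]
    exact Int.emod_lt_of_pos _ hm0
  · linarith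
  · linarith

/-- Two canonical representatives of the same arc agree. -/
theorem eq_of_translate {m : ℕ} {p q j k : ℤ} (h : IsPArc m (p + j * m, q + j * m))
    (h' : IsPArc m (p + k * m, q + k * m)) : j = k := by
  have h1 := h.1
  have h2 := h.2.1
  have h3 := h'.1
  have h4 := h'.2.1
  dsimp only at h1 h2 h3 h4
  have := eq_zero_of_mul_lt (m := (m : ℤ)) (k := j - k) (by linarith) (by linarith)
  omega

/-- Adding a new arc to a noncrossing set, after removing all the arcs that it crosses. -/
theorem IsNoncrossing.insert {m : ℕ} {S : Finset (ℤ × ℤ)} (hS : IsNoncrossing m S) {l d j : ℤ}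
    (hj : IsPArc m (l + j * m, d + j * m))
    (hx : ∀ p q, IsLift m S p q →
      ¬ (p < l ∧ l < q ∧ q < d) ∧ ¬ (l < p ∧ p < d ∧ d < q)) :
    IsNoncrossing m (insert (l + j * (m : ℤ), d + j * (m : ℤ)) S) := by
  refine ⟨?_, ?_⟩
  · intro p hp
    rcases Finset.mem_insert.mp hp with rfl | hp
    · exact hj
    · exact hS.1 p hp
  · intro p hp q hq hpq
    rcases Finset.mem_insert.mp hp with rfl | hp <;> rcases Finset.mem_insert.mp hq with rfl | hq
    · exact absurd rfl hpq
    · rintro ⟨k, h⟩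
      have := hx _ _ ((isLift_of_mem (m := m) (p := q.1) (q := q.2) hq).add_mul (-(j + k)))
      have e : (j + k) * (m : ℤ) = j * m + k * m := by ring
      rw [neg_mul, e] at this
      dsimp only at h
      omega
    · rintro ⟨k, h⟩
      have := hx _ _ ((isLift_of_mem (m := m) (p := p.1) (q := p.2) hp).add_mul (k - j))
      have e : (k - j) * (m : ℤ) = k * m - j * m := by ring
      rw [e] at this
      dsimp only at h
      omega
    · exact hS.2 p hp q hq hpq

theorem IsPTriangulation.isLift_of_not_cross {m : ℕ} (hm : 2 ≤ m) {T : Finset (ℤ × ℤ)}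
    (hT : IsPTriangulation m T) {l d : ℤ} (h₁ : l + 2 ≤ d) (h₂ : d ≤ l + m)
    (hx : ∀ p q, IsLift m T p q →
      ¬ (p < l ∧ l < q ∧ q < d) ∧ ¬ (l < p ∧ p < d ∧ d < q)) :
    IsLift m T l d := by
  obtain ⟨j, hj⟩ := exists_canonical hm h₁ h₂
  refine ⟨j, ?_⟩
  by_contra hn
  have h := (hT.isNoncrossing.insert hj hx).card_le
  rw [Finset.card_insert_of_notMem hn, hT.1] at h
  omega

theorem IsPTriangulation.exists_loop {m : ℕ} (hm : 2 ≤ m) {T : Finset (ℤ × ℤ)}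
    (hT : IsPTriangulation m T) : ∃ a : ℤ, (a, a + (m : ℤ)) ∈ T := by
  have hne : T.Nonempty := by
    rw [← Finset.card_pos, hT.1]
    omega
  obtain ⟨a, -, -, ha⟩ := exists_lift_endpoint hT.isNoncrossing hne
  obtain ⟨k, hk⟩ : IsLift m T a (a + m) := by
    refine hT.isLift_of_not_cross hm (by omega) le_rfl fun p q h => ?_
    have h1 := ha _ _ h
    have h2 := ha _ _ (h.add_mul (-1))
    omega
  refine ⟨a + k * m, ?_⟩
  convert hk using 2
  ring

theorem IsPTriangulation.exists_apex {m : ℕ} (hm : 2 ≤ m) {T : Finset (ℤ × ℤ)}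
    (hT : IsPTriangulation m T) {l r : ℤ} (h : IsLift m T l r) :
    ∃ c, l < c ∧ c < r ∧ IsSide m T l c ∧ IsSide m T c r := by
  have hS := hT.isNoncrossing
  have hlen := h.length hS
  obtain ⟨c, ⟨hlc, hcr, hc⟩, hmax⟩ := Int.exists_greatest_of_bdd
    (P := fun c => l < c ∧ c < r ∧ IsSide m T l c)
    ⟨r, fun z hz => hz.2.1.le⟩ ⟨l + 1, by omega, by omega, Or.inl rfl⟩
  refine ⟨c, hlc, hcr, hc, ?_⟩
  by_cases hr : r = c + 1
  · exact Or.inl hr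
  refine Or.inr (hT.isLift_of_not_cross hm (by omega) (by omega) fun p q hpq => ⟨?_, ?_⟩)
  · rintro ⟨h1, h2, h3⟩
    rcases lt_trichotomy p l with h4 | rfl | h4
    · exact hpq.not_cross hS h ⟨h4, by omega, h3⟩
    · have := hmax q ⟨by omega, h3, Or.inr hpq⟩
      omega
    · rcases hc with hc | hc
      · omega
      · exact hc.not_cross hS hpq ⟨h4, h1, h2⟩
  · rintro ⟨h1, h2, h3⟩
    exact h.not_cross hS hpq ⟨by omega, h2, h3⟩

theorem IsPTriangulation.flip {m : ℕ} (hm : 2 ≤ m) {T : Finset (ℤ × ℤ)}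
    (hT : IsPTriangulation m T) {l d c r j k : ℤ} (he : (c + k * (m : ℤ), r + k * (m : ℤ)) ∈ T)
    (hj : IsPArc m (l + j * m, d + j * m)) (hn : ¬ IsLift m T l d)
    (hx : ∀ p q, IsLift m T p q → (p < l ∧ l < q ∧ q < d) ∨ (l < p ∧ p < d ∧ d < q) →
      ∃ i : ℤ, p = c + i * m ∧ q = r + i * m) :
    IsPTriangulation m (insert (l + j * (m : ℤ), d + j * (m : ℤ))
      (T.erase (c + k * (m : ℤ), r + k * (m : ℤ)))) ∧
    (insert (l + j * (m : ℤ), d + j * (m : ℤ))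
      (T.erase (c + k * (m : ℤ), r + k * (m : ℤ))) ∩ T).card = m - 2 := by
  have hn' : (l + j * (m : ℤ), d + j * (m : ℤ)) ∉ T := fun h => hn ⟨j, h⟩
  have hE : IsNoncrossing m (T.erase (c + k * (m : ℤ), r + k * (m : ℤ))) :=
    ⟨fun p hp => hT.2.1 p (Finset.mem_of_mem_erase hp), fun p hp q hq =>
      hT.2.2 p (Finset.mem_of_mem_erase hp) q (Finset.mem_of_mem_erase hq)⟩
  have hcard := Finset.card_erase_of_mem he
  have h1 := hT.1
  refine ⟨⟨?_, hE.insert hj ?_⟩, ?_⟩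
  · rw [Finset.card_insert_of_notMem (fun h => hn' (Finset.mem_of_mem_erase h))]
    omega
  · rintro p q ⟨i, hi⟩
    rw [← not_or]
    intro hcr
    obtain ⟨hne, hi'⟩ := Finset.mem_erase.mp hi
    obtain ⟨i', rfl, rfl⟩ := hx p q ⟨i, hi'⟩ hcr
    have e1 : c + i' * (m : ℤ) + i * m = c + (i' + i) * m := by ring
    have e2 : r + i' * (m : ℤ) + i * m = r + (i' + i) * m := by ring
    rw [e1, e2] at hne hi'
    have := eq_of_translate (hT.2.1 _ hi') (hT.2.1 _ he)
    rw [this] at hne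
    exact hne rfl
  · rw [Finset.insert_inter_of_notMem hn', Finset.inter_eq_left.mpr (Finset.erase_subset _ _)]
    omega

open Classical in
/-- The base point of a loop in `T`. -/
noncomputable def loopBase (m : ℕ) (T : Finset (ℤ × ℤ)) : ℤ :=
  if h : ∃ a : ℤ, (a, a + (m : ℤ)) ∈ T then h.choose else 0

theorem loopBase_eq {m : ℕ} {T : Finset (ℤ × ℤ)} (hT : IsPTriangulation m T) {a : ℤ}
    (ha : (a, a + (m : ℤ)) ∈ T) : loopBase m T = a := by
  have h : ∃ a : ℤ, (a, a + (m : ℤ)) ∈ T := ⟨a, ha⟩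
  rw [loopBase, dif_pos h]
  have hb := h.choose_spec
  generalize h.choose = b at hb
  have h1 := hT.2.1 _ ha
  have h2 := hT.2.1 _ hb
  have h3 := (isLift_of_mem (m := m) ha).not_cross hT.isNoncrossing (isLift_of_mem hb)
  have h4 := (isLift_of_mem (m := m) hb).not_cross hT.isNoncrossing (isLift_of_mem ha)
  simp only [IsPArc] at h1 h2
  omega

/-- The sum of the endpoints of the arc `x`, up to a constant, after translating it to have its left
endpoint in `[a, a + m)`. -/
def arcWeight (m : ℕ) (a : ℤ) (x : ℤ × ℤ) : ℤ := 2 * ((x.1 - a) % m) + (x.2 - x.1)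

theorem arcWeight_translate {m : ℕ} {a p q k : ℤ} (h₁ : a ≤ p) (h₂ : p < a + m) :
    arcWeight m a (p + k * m, q + k * m) = p + q - 2 * a := by
  have e : p + k * (m : ℤ) - a = p - a + k * m := by ring
  rw [arcWeight, e, Int.add_mul_emod_self_right, Int.emod_eq_of_lt (by omega) (by omega)]
  ring

/-- The potential that orders the triangulations: first the base of the loop, then the total
weight. -/
noncomputable def potential (m : ℕ) (T : Finset (ℤ × ℤ)) : ℤ ×ₗ ℤ :=
  toLex (loopBase m T, ∑ x ∈ T, arcWeight m (loopBase m T) x)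

/-- `T` has a neighbour of smaller potential containing `T ∩ T'`. -/
def HasDescent (m : ℕ) (T T' : Finset (ℤ × ℤ)) : Prop :=
  ∃ U, IsPTriangulation m U ∧ potential m U < potential m T ∧ (U ∩ T).card = m - 2 ∧ T ∩ T' ⊆ U

theorem inter_subset_insert_erase {m : ℕ} {T T' : Finset (ℤ × ℤ)} {c r k : ℤ}
    (h : ¬ IsLift m T' c r) (y : ℤ × ℤ) :
    T ∩ T' ⊆ insert y (T.erase (c + k * (m : ℤ), r + k * (m : ℤ))) := by
  intro x hx
  obtain ⟨h1, h2⟩ := Finset.mem_inter.mp hx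
  refine Finset.mem_insert_of_mem (Finset.mem_erase.mpr ⟨?_, h1⟩)
  rintro rfl
  exact h ⟨k, h2⟩

/-- Flipping the diagonal `(c, r)` of the quadrilateral `l < c < d < r` to `(l, d)` lowers the
potential. -/
theorem hasDescent_of_diagonal {m : ℕ} (hm : 2 ≤ m) {T T' : Finset (ℤ × ℤ)}
    (hT : IsPTriangulation m T) {a l c r : ℤ} (ha : (a, a + (m : ℤ)) ∈ T)
    (hal : a ≤ l) (hlc : l < c) (hra : r ≤ a + m) (hlr : IsLift m T l r)
    (hl : IsSide m T l c) (hr : IsLift m T c r) (hT' : ¬ IsLift m T' c r) :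
    HasDescent m T T' := by
  have hS := hT.isNoncrossing
  obtain ⟨d, hcd, hdr, h1, h2⟩ := hT.exists_apex hm hr
  obtain ⟨j, hj⟩ := exists_canonical hm (l := l) (d := d) (by omega) (by omega)
  have hn : ¬ IsLift m T l d := fun h => h.not_cross hS hr ⟨hlc, hcd, hdr⟩
  have hr' := hr
  obtain ⟨k, hk⟩ := hr'
  have hflip := hT.flip hm hk hj hn (by
    intro p q hpq hcr
    refine ⟨0, ?_⟩
    have n1 := hpq.not_cross hS hlr
    have n2 := hlr.not_cross hS hpq
    have n3 : ¬ (l < p ∧ p < c ∧ c < q) := by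
      rcases hl with h | h
      · omega
      · exact h.not_cross hS hpq
    have n4 : ¬ (c < p ∧ p < d ∧ d < q) := by
      rcases h1 with h | h
      · omega
      · exact h.not_cross hS hpq
    have n5 : ¬ (p < d ∧ d < q ∧ q < r) := by
      rcases h2 with h | h
      · omega
      · exact hpq.not_cross hS h
    rw [zero_mul]
    omega)
  refine ⟨_, hflip.1, ?_, hflip.2, inter_subset_insert_erase hT' _⟩
  have hbase := loopBase_eq hflip.1 (a := a) (Finset.mem_insert_of_mem (Finset.mem_erase.mpr
    ⟨fun h => by rw [Prod.mk.injEq] at h; omega, ha⟩))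
  rw [potential, potential, Prod.Lex.toLex_lt_toLex, hbase, loopBase_eq hT ha]
  refine Or.inr ⟨rfl, ?_⟩
  dsimp only
  rw [Finset.sum_insert (fun h => hn ⟨j, Finset.mem_of_mem_erase h⟩),
    ← Finset.add_sum_erase T _ hk, arcWeight_translate hal (by omega),
    arcWeight_translate (by omega) (by omega)]
  omega

/-- Flipping the loop at `a` to a loop based at a smaller vertex lowers the potential. -/
theorem hasDescent_of_loop {m : ℕ} (hm : 2 ≤ m) {T T' : Finset (ℤ × ℤ)}
    (hT : IsPTriangulation m T) {a c : ℤ} (ha : (a, a + (m : ℤ)) ∈ T) (hmc : m ≤ c)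
    (hac : a < c) (hca : c < a + m) (hl : IsSide m T a c) (hr : IsSide m T c (a + m))
    (hT' : ¬ IsLift m T' a (a + m)) : HasDescent m T T' := by
  have hS := hT.isNoncrossing
  have hL : IsLift m T a (a + m) := isLift_of_mem ha
  have ham := hT.2.1 _ ha
  simp only [IsPArc] at ham
  have hn : ¬ IsLift m T (c - m) c := by
    intro h
    exact h.not_cross hS hL ⟨by omega, by omega, by omega⟩
  have key : ∀ p q, IsLift m T p q → p < c → c < q → p = a ∧ q = a + m := by
    intro p q hpq hpc hcq
    have n0 := hpq.length hS
    have n1 := hpq.not_cross hS hL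
    have n2 := hL.not_cross hS hpq
    have n3 : ¬ (a < p ∧ p < c ∧ c < q) := by
      rcases hl with h | h
      · omega
      · exact h.not_cross hS hpq
    have n4 : ¬ (p < c ∧ c < q ∧ q < a + m) := by
      rcases hr with h | h
      · omega
      · exact hpq.not_cross hS h
    omega
  have hflip := hT.flip hm (c := a) (r := a + m) (k := 0) (l := c - m) (d := c) (j := 0)
    (by simpa using ha) (by simp only [IsPArc]; omega) hn (by
    intro p q hpq hcr
    have n0 := hpq.length hS
    rcases hcr with h | h
    · have := key _ _ (hpq.add_mul 1) (by omega) (by omega)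
      exact ⟨-1, by omega, by omega⟩
    · have := key _ _ hpq (by omega) (by omega)
      exact ⟨0, by omega, by omega⟩)
  refine ⟨_, hflip.1, ?_, hflip.2, inter_subset_insert_erase hT' _⟩
  have hbase := loopBase_eq hflip.1 (a := c - m) (by simp)
  rw [potential, potential, Prod.Lex.toLex_lt_toLex, hbase, loopBase_eq hT ha]
  exact Or.inl (by dsimp only; omega)

theorem hasDescent_of_loop_lt {m : ℕ} (hm : 2 ≤ m) {T T' : Finset (ℤ × ℤ)}
    (hT : IsPTriangulation m T) (hT' : IsPTriangulation m T') {a a' : ℤ}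
    (ha : (a, a + (m : ℤ)) ∈ T) (ha' : (a', a' + (m : ℤ)) ∈ T') (hlt : a' < a) :
    HasDescent m T T' := by
  have hS' := hT'.isNoncrossing
  have hL : IsLift m T a (a + m) := isLift_of_mem ha
  have hL' : IsLift m T' a' (a' + m) := isLift_of_mem ha'
  have ham := hT.2.1 _ ha
  have ham' := hT'.2.1 _ ha'
  simp only [IsPArc] at ham ham'
  obtain ⟨c, hac, hca, h1, h2⟩ := hT.exists_apex hm hL
  by_cases hmc : (m : ℤ) ≤ c
  · exact hasDescent_of_loop hm hT ha hmc hac hca h1 h2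
      fun h => hL'.not_cross hS' h ⟨by omega, by omega, by omega⟩
  · refine hasDescent_of_diagonal hm hT ha le_rfl hac le_rfl hL h1 ?_
      fun h => hL'.not_cross hS' h ⟨by omega, by omega, by omega⟩
    rcases h2 with h2 | h2
    · omega
    · exact h2

/-- Two triangulations with a common base `(l, r)` either agree below it, or one of them has a
descent. -/
theorem isLift_of_not_hasDescent {m : ℕ} (hm : 2 ≤ m) {T T' : Finset (ℤ × ℤ)}
    (hT : IsPTriangulation m T) (hT' : IsPTriangulation m T') {a : ℤ}
    (ha : (a, a + (m : ℤ)) ∈ T) (ha' : (a, a + (m : ℤ)) ∈ T')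
    (hd : ¬ HasDescent m T T') (hd' : ¬ HasDescent m T' T) (n : ℕ) :
    ∀ l r : ℤ, r - l ≤ n → a ≤ l → r ≤ a + m → IsLift m T l r → IsLift m T' l r →
      ∀ p q, l ≤ p → q ≤ r → IsLift m T p q → IsLift m T' p q := by
  have hS := hT.isNoncrossing
  have hS' := hT'.isNoncrossing
  induction n with
  | zero =>
    intro l r hn _ _ hlr
    have := hlr.length hS
    omega
  | succ n ih =>
    intro l r hn hal hra hlr hlr' p q hlp hqr hpq
    obtain ⟨c, hlc, hcr, h1, h2⟩ := hT.exists_apex hm hlr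
    obtain ⟨c', hlc', hcr', h1', h2'⟩ := hT'.exists_apex hm hlr'
    have hcc : c = c' := by
      rcases lt_trichotomy c c' with h | h | h
      · have h2 := h2.resolve_left (by omega)
        have h1' := h1'.resolve_left (by omega)
        exact absurd (hasDescent_of_diagonal hm hT ha hal hlc hra hlr h1 h2
          fun h3 => h1'.not_cross hS' h3 ⟨hlc, h, hcr'⟩) hd
      · exact h
      · have h2' := h2'.resolve_left (by omega)
        have h1 := h1.resolve_left (by omega)
        exact absurd (hasDescent_of_diagonal hm hT' ha' hal hlc' hra hlr' h1' h2'
          fun h3 => h1.not_cross hS h3 ⟨hlc', h, hcr⟩) hd'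
    subst hcc
    have hlen := hpq.length hS
    have n1 : ¬ (l < p ∧ p < c ∧ c < q) := by
      rcases h1 with h | h
      · omega
      · exact h.not_cross hS hpq
    have n2 : ¬ (p < c ∧ c < q ∧ q < r) := by
      rcases h2 with h | h
      · omega
      · exact hpq.not_cross hS h
    by_cases hqc : q ≤ c
    · exact ih l c (by omega) hal (by omega) (h1.resolve_left (by omega))
        (h1'.resolve_left (by omega)) p q hlp hqc hpq
    by_cases hcp : c ≤ p
    · exact ih c r (by omega) (by omega) hra (h2.resolve_left (by omega))
        (h2'.resolve_left (by omega)) p q hcp hqr hpq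
    obtain ⟨rfl, rfl⟩ : p = l ∧ q = r := by omega
    exact hlr'

theorem subset_of_not_hasDescent {m : ℕ} (hm : 2 ≤ m) {T T' : Finset (ℤ × ℤ)}
    (hT : IsPTriangulation m T) (hT' : IsPTriangulation m T') {a : ℤ}
    (ha : (a, a + (m : ℤ)) ∈ T) (ha' : (a, a + (m : ℤ)) ∈ T')
    (hd : ¬ HasDescent m T T') (hd' : ¬ HasDescent m T' T) : T ⊆ T' := by
  intro x hx
  have hS := hT.isNoncrossing
  have hL : IsLift m T a (a + m) := isLift_of_mem ha
  have hlx : IsLift m T x.1 x.2 := isLift_of_mem hx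
  have key := isLift_of_not_hasDescent hm hT hT' ha ha' hd hd' m a (a + m) (by omega) le_rfl
    le_rfl hL (isLift_of_mem ha')
  have hxa := hT.2.1 x hx
  have haa := hT.2.1 _ ha
  have hx' : IsLift m T' x.1 x.2 := by
    have n1 := hlx.not_cross hS hL
    have n2 := hL.not_cross hS hlx
    simp only [IsPArc] at hxa haa
    by_cases h : x.1 < a
    · have := (key _ _ (by omega) (by omega) (hlx.add_mul 1)).add_mul (-1)
      simpa using this
    · exact key _ _ (by omega) (by omega) hlx
  obtain ⟨k, hk⟩ := hx'
  have : (0 : ℤ) = k := eq_of_translate (p := x.1) (q := x.2) (by simpa using hxa) (hT'.2.1 _ hk)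
  subst this
  simpa using hk

theorem hasDescent_or_hasDescent {m : ℕ} (hm : 2 ≤ m) {T T' : Finset (ℤ × ℤ)}
    (hT : IsPTriangulation m T) (hT' : IsPTriangulation m T') (hne : T ≠ T') :
    HasDescent m T T' ∨ HasDescent m T' T := by
  obtain ⟨a, ha⟩ := hT.exists_loop hm
  obtain ⟨a', ha'⟩ := hT'.exists_loop hm
  rcases lt_trichotomy a a' with h | rfl | h
  · exact Or.inr (hasDescent_of_loop_lt hm hT' hT ha' ha h)
  · by_contra hcon
    obtain ⟨hd, hd'⟩ := not_or.mp hcon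
    exact hne ((subset_of_not_hasDescent hm hT hT' ha ha' hd hd').antisymm
      (subset_of_not_hasDescent hm hT' hT ha' ha hd' hd))
  · exact Or.inl (hasDescent_of_loop_lt hm hT hT' ha ha' h)

theorem finite_isPTriangulation (m : ℕ) : {T | IsPTriangulation m T}.Finite := by
  refine (Finset.finite_toSet
    (Finset.Ico (0 : ℤ) m ×ˢ Finset.Icc (0 : ℤ) (2 * m)).powerset).subset fun T hT => ?_
  rw [Finset.mem_coe, Finset.mem_powerset]
  intro x hx
  have := hT.2.1 x hx
  simp only [IsPArc] at this
  rw [Finset.mem_product, Finset.mem_Ico, Finset.mem_Icc]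
  omega

/-- For `P*_m` (`m ≥ 2`), there is an enumeration `T_1, …, T_N` of all
triangulations such that for all `j < k` there exists `i < k` with
`|T_i ∩ T_k| = m - 2` and `T_j ∩ T_k ⊆ T_i ∩ T_k` (the arc complex of a once-punctured
polygon is shellable). -/
theorem arc_complex_shellable (m : ℕ) (hm : 2 ≤ m) :
    ∃ N : ℕ, ∃ f : Fin N → Finset (ℤ × ℤ),
      Function.Injective f ∧
      (∀ i, IsPTriangulation m (f i)) ∧
      (∀ T, IsPTriangulation m T → ∃ i, f i = T) ∧
      ∀ j k : Fin N, j < k →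
        ∃ i : Fin N, i < k ∧ (f i ∩ f k).card = m - 2 ∧ f j ∩ f k ⊆ f i ∩ f k := by
  have hmem : ∀ T, T ∈ (finite_isPTriangulation m).toFinset ↔ IsPTriangulation m T := fun T => by
    simp
  obtain ⟨N, f, hinj, hf, hsurj, hshell⟩ := exists_shelling_of_potential
    (finite_isPTriangulation m).toFinset (m - 2) (potential m) (by
      intro S hS T hT hne
      simp only [hmem] at hS hT ⊢
      exact hasDescent_or_hasDescent hm hS hT hne)
  exact ⟨N, f, hinj, fun i => (hmem _).mp (hf i), fun T hT => hsurj T ((hmem T).mpr hT), hshell⟩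

end Punc
end

section
/- Let the convex m-gon P_m (m ≥ 4) carry a non-trivial bicolouring, with its vertices labelled 1, 2, …, m in cyclic order so that vertex 1 is blue and vertex m is red. Then every permissible triangulation T of P_m satisfies exactly one of the following: (i) {1, m−1} ∈ T; (ii) {2, m} ∈ T, and then vertex 2 is blue; (iii) there exists k with 3 ≤ k ≤ m−2 such that {1, k} ∈ T and {k, m} ∈ T, and then vertex k is blue; moreover the k in (iii) is unique. -/
/-!
Vertices of the convex `m`-gon `P_m` are identified with `ZMod m` in cyclic order.
Blue is encoded by the Boolean value `true`, red by `false`.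
-/

namespace Poly

/-- A diagonal of `P_m`: an unordered pair `{i, j}` of vertices with
`j - i ≢ 0, 1, -1 (mod m)`. -/
def IsDiag (m : ℕ) (e : Sym2 (ZMod m)) : Prop :=
  ∃ i j : ZMod m, e = s(i, j) ∧ j - i ≠ 0 ∧ j - i ≠ 1 ∧ j - i ≠ -1

/-- `x` lies in the open cyclic interval from `a` to `b` (going in the positive
cyclic direction). -/
def StrictBtw (m : ℕ) (a x b : ZMod m) : Prop :=
  0 < (x - a).val ∧ (x - a).val < (b - a).val

/-- Two diagonals `{a,b}` and `{c,d}` cross: their four endpoints are distinct and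
exactly one of `c`, `d` lies in the open cyclic interval from `a` to `b`. -/
def Cross (m : ℕ) (e f : Sym2 (ZMod m)) : Prop :=
  ∃ a b c d : ZMod m, e = s(a, b) ∧ f = s(c, d) ∧
    a ≠ b ∧ a ≠ c ∧ a ≠ d ∧ b ≠ c ∧ b ≠ d ∧ c ≠ d ∧
    Xor' (StrictBtw m a c b) (StrictBtw m a d b)

/-- A triangulation of `P_m`: a set of `m - 3` pairwise non-crossing diagonals. -/
def IsTriangulation (m : ℕ) (T : Finset (Sym2 (ZMod m))) : Prop :=
  T.card = m - 3 ∧ (∀ e ∈ T, IsDiag m e) ∧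
    ∀ e ∈ T, ∀ f ∈ T, e ≠ f → ¬ Cross m e f

/-- A bicolouring: a function from the vertices to {red, blue} attaining both values
(`true` = blue, `false` = red). -/
def IsBicolouring (m : ℕ) (c : ZMod m → Bool) : Prop :=
  (∃ v, c v = true) ∧ (∃ v, c v = false)

/-- A bicolouring is non-trivial if some diagonal has both endpoints red. -/
def IsNontrivialBicolouring (m : ℕ) (c : ZMod m → Bool) : Prop :=
  IsBicolouring m c ∧ ∃ i j : ZMod m, IsDiag m s(i, j) ∧ c i = false ∧ c j = false

/-- A diagonal is permitted if at least one of its endpoints is blue. -/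
def Permitted (m : ℕ) (c : ZMod m → Bool) (e : Sym2 (ZMod m)) : Prop :=
  ∃ v ∈ e, c v = true

/-- A permissible triangulation: a triangulation all of whose diagonals are permitted. -/
def IsPermissible (m : ℕ) (c : ZMod m → Bool) (T : Finset (Sym2 (ZMod m))) : Prop :=
  IsTriangulation m T ∧ ∀ e ∈ T, Permitted m c e

/-- Two permissible triangulations are joined in the flip graph of permissible
triangulations: there is a finite sequence of permissible triangulations from one to the
other in which consecutive triangulations share exactly `m - 4` diagonals. -/
def PermFlipJoined (m : ℕ) (c : ZMod m → Bool) (T₁ T₂ : Finset (Sym2 (ZMod m))) : Prop :=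
  ∃ n : ℕ, ∃ f : Fin (n + 1) → Finset (Sym2 (ZMod m)),
    f 0 = T₁ ∧ f (Fin.last n) = T₂ ∧ (∀ i, IsPermissible m c (f i)) ∧
    ∀ i : Fin n, (f i.castSucc ∩ f i.succ).card = m - 4


/-- Alternative (iii) of Statement 19: there is `k` with `3 ≤ k ≤ m - 2` such that the
diagonals `{1, k}` and `{k, m}` both belong to `T`. -/
def Cond3 (m : ℕ) (T : Finset (Sym2 (ZMod m))) (k : ℕ) : Prop :=
  3 ≤ k ∧ k ≤ m - 2 ∧
    s((1 : ZMod m), ((k : ℕ) : ZMod m)) ∈ T ∧ s(((k : ℕ) : ZMod m), ((m : ℕ) : ZMod m)) ∈ T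

section Arcs

open Classical in
/-- The largest `k < b` such that `k = a + 1` or `(a, k)` is an arc of `S`. -/
noncomputable def apex (S : Finset (ℕ × ℕ)) (a b : ℕ) : ℕ :=
  Nat.findGreatest (fun k => k = a + 1 ∨ (a, k) ∈ S) (b - 1)

variable {S : Finset (ℕ × ℕ)} {a b : ℕ}

lemma apex_spec (h : a + 2 ≤ b) : apex S a b = a + 1 ∨ (a, apex S a b) ∈ S := by
  classical
  exact Nat.findGreatest_spec (P := fun k => k = a + 1 ∨ (a, k) ∈ S)
    (show a + 1 ≤ b - 1 by omega) (Or.inl rfl)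

lemma apex_lt (h : a + 2 ≤ b) : apex S a b < b := by
  classical
  have := Nat.findGreatest_le (P := fun k => k = a + 1 ∨ (a, k) ∈ S) (b - 1)
  unfold apex
  omega

lemma lt_apex (h : a + 2 ≤ b) : a < apex S a b := by
  classical
  have := Nat.le_findGreatest (P := fun k => k = a + 1 ∨ (a, k) ∈ S)
    (show a + 1 ≤ b - 1 by omega) (Or.inl rfl)
  unfold apex
  omega

lemma le_apex {k : ℕ} (hk : (a, k) ∈ S) (hkb : k < b) : k ≤ apex S a b := by
  classical
  exact Nat.le_findGreatest (P := fun k => k = a + 1 ∨ (a, k) ∈ S)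
    (show k ≤ b - 1 by omega) (Or.inr hk)

/-- In a non-crossing family of arcs, an arc is determined by its apex. -/
lemma apex_injOn (hlen : ∀ a b, (a, b) ∈ S → a + 2 ≤ b)
    (hcross : ∀ a b c d, (a, b) ∈ S → (c, d) ∈ S → a < c → c < b → b < d → False) :
    Set.InjOn (fun p : ℕ × ℕ => apex S p.1 p.2) (S : Set (ℕ × ℕ)) := by
  have key : ∀ a b c d, (a, b) ∈ S → (c, d) ∈ S → apex S a b = apex S c d → ¬ a < c := by
    intro a b c d h h' he hac
    have h1 := lt_apex (S := S) (hlen _ _ h')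
    have h2 := apex_lt (S := S) (hlen _ _ h')
    rcases apex_spec (S := S) (hlen _ _ h) with h3 | h3
    · omega
    · exact hcross _ _ _ _ h3 h' hac (by omega) (by omega)
  have key' : ∀ a b d, (a, b) ∈ S → (a, d) ∈ S → apex S a b = apex S a d → ¬ b < d := by
    intro a b d h h' he hbd
    have h1 := le_apex h hbd
    have h2 := apex_lt (S := S) (hlen _ _ h)
    omega
  rintro ⟨a, b⟩ h ⟨c, d⟩ h' he
  simp only [Finset.mem_coe] at h h' he
  have hac : a = c := by
    have := key _ _ _ _ h h' he
    have := key _ _ _ _ h' h he.symm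
    omega
  subst hac
  have := key' _ _ _ h h' he
  have := key' _ _ _ h' h he.symm
  rw [show b = d by omega]

/-- In a non-crossing family of arcs on `{l, …, r}` of maximal size, the outer arc `(l, r)`
is a side of a triangle. -/
lemma exists_triangle {l r : ℕ} (hlr : (l, r) ∈ S)
    (hmem : ∀ a b, (a, b) ∈ S → l ≤ a ∧ a + 2 ≤ b ∧ b ≤ r)
    (hcross : ∀ a b c d, (a, b) ∈ S → (c, d) ∈ S → a < c → c < b → b < d → False)
    (hcard : r - l - 1 ≤ S.card) :
    ∃ k, l < k ∧ k < r ∧ (k = l + 1 ∨ (l, k) ∈ S) ∧ (k + 1 = r ∨ (k, r) ∈ S) := by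
  have hlen : ∀ a b, (a, b) ∈ S → a + 2 ≤ b := fun a b h => (hmem a b h).2.1
  have hsurj : Set.SurjOn (fun p : ℕ × ℕ => apex S p.1 p.2) S (Finset.Ioo l r) := by
    apply Finset.surjOn_of_injOn_of_card_le _ _ (apex_injOn hlen hcross)
    · simpa using hcard
    · rintro ⟨a, b⟩ h
      have h0 := hmem _ _ h
      have h1 := lt_apex (S := S) h0.2.1
      have h2 := apex_lt (S := S) h0.2.1
      simp only [Finset.coe_Ioo, Set.mem_Ioo]
      omega
  have hk1 := lt_apex (S := S) (hlen _ _ hlr)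
  have hk2 := apex_lt (S := S) (hlen _ _ hlr)
  have hk3 := apex_spec (S := S) (hlen _ _ hlr)
  have hkmax : ∀ b, (l, b) ∈ S → b < r → b ≤ apex S l r := fun b hb hbr => le_apex hb hbr
  refine ⟨apex S l r, hk1, hk2, hk3, ?_⟩
  generalize hk : apex S l r = k at *
  by_contra! hcon
  obtain ⟨hkr, hkS⟩ := hcon
  have hlen' : k + 2 ≤ r := by omega
  have hj1 := lt_apex (S := S) hlen'
  have hj2 := apex_lt (S := S) hlen'
  have hj3 := apex_spec (S := S) hlen'
  obtain ⟨⟨a, b⟩, hab, he⟩ := hsurj (show apex S k r ∈ (Finset.Ioo l r : Set ℕ) by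
    simp only [Finset.coe_Ioo, Set.mem_Ioo]; omega)
  simp only [Finset.mem_coe] at hab he
  have hm := hmem _ _ hab
  have hb := apex_lt (S := S) hm.2.1
  have ha := lt_apex (S := S) hm.2.1
  rcases lt_trichotomy a k with h | h | h
  · rcases Nat.eq_or_lt_of_le hm.1 with h' | h'
    · subst h'
      rcases Nat.eq_or_lt_of_le hm.2.2 with h'' | h''
      · simp only [h'', hk] at he
        omega
      · have := hkmax _ hab h''
        omega
    · rcases hk3 with h3 | h3
      · omega
      · exact hcross _ _ _ _ h3 hab h' h (by omega)
  · subst h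
    rcases Nat.eq_or_lt_of_le hm.2.2 with h'' | h''
    · subst h''
      exact hkS hab
    · have := le_apex hab h''
      omega
  · rcases hj3 with h3 | h3
    · omega
    · exact hcross _ _ _ _ h3 hab h (by omega) (by omega)

end Arcs

section Labels

variable {m : ℕ}

lemma isDiag_mk_iff {i j : ZMod m} :
    IsDiag m s(i, j) ↔ j - i ≠ 0 ∧ j - i ≠ 1 ∧ j - i ≠ -1 := by
  constructor
  · rintro ⟨a, b, he, h0, h1, h2⟩
    rcases Sym2.eq_iff.mp he with ⟨rfl, rfl⟩ | ⟨rfl, rfl⟩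
    · exact ⟨h0, h1, h2⟩
    · refine ⟨fun h => h0 ?_, fun h => h2 ?_, fun h => h1 ?_⟩ <;>
        rw [← neg_sub, h] <;> simp
  · rintro ⟨h0, h1, h2⟩
    exact ⟨i, j, rfl, h0, h1, h2⟩

lemma natCast_ne_natCast {a b : ℕ} (hab : a < b) (hb : b < a + m) :
    (a : ZMod m) ≠ (b : ZMod m) := by
  intro h
  rw [ZMod.natCast_eq_natCast_iff, Nat.modEq_iff_dvd' hab.le] at h
  have := Nat.le_of_dvd (by omega) h
  omega

lemma val_natCast_sub_natCast {a b : ℕ} (hab : a ≤ b) (hb : b < a + m) :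
    ((b : ZMod m) - (a : ZMod m)).val = b - a := by
  rw [← Nat.cast_sub hab, ZMod.val_natCast_of_lt (by omega)]

lemma cross_natCast {a b c d : ℕ} (hac : a < c) (hcb : c < b) (hbd : b < d) (hd : d < a + m) :
    Cross m s((a : ZMod m), (b : ZMod m)) s((c : ZMod m), (d : ZMod m)) := by
  refine ⟨a, b, c, d, rfl, rfl, natCast_ne_natCast (by omega) (by omega),
    natCast_ne_natCast (by omega) (by omega), natCast_ne_natCast (by omega) (by omega),
    (natCast_ne_natCast (by omega) (by omega)).symm, natCast_ne_natCast (by omega) (by omega),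
    natCast_ne_natCast (by omega) (by omega), Or.inl ⟨?_, ?_⟩⟩
  · unfold StrictBtw
    rw [val_natCast_sub_natCast (by omega) (by omega), val_natCast_sub_natCast (by omega) (by omega)]
    omega
  · unfold StrictBtw
    rw [val_natCast_sub_natCast (by omega) (by omega), val_natCast_sub_natCast (by omega) (by omega)]
    omega

variable {T : Finset (Sym2 (ZMod m))}

lemma IsTriangulation.not_interleaved (hT : IsTriangulation m T) {a b c d : ℕ}
    (hab : s((a : ZMod m), (b : ZMod m)) ∈ T) (hcd : s((c : ZMod m), (d : ZMod m)) ∈ T)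
    (hac : a < c) (hcb : c < b) (hbd : b < d) (hd : d < a + m) : False := by
  refine hT.2.2 _ hab _ hcd (fun h => ?_) (cross_natCast hac hcb hbd hd)
  have h1 : (a : ZMod m) ≠ c := natCast_ne_natCast (by omega) (by omega)
  have h2 : (a : ZMod m) ≠ d := natCast_ne_natCast (by omega) (by omega)
  rcases Sym2.eq_iff.mp h with ⟨h, -⟩ | ⟨h, -⟩
  · exact h1 h
  · exact h2 h

lemma exists_natCast_eq (hm : 0 < m) (z : ZMod m) : ∃ a : ℕ, 1 ≤ a ∧ a ≤ m ∧ (a : ZMod m) = z := by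
  have : NeZero m := ⟨hm.ne'⟩
  refine ⟨(z - 1).val + 1, by omega, ZMod.val_lt _, ?_⟩
  push_cast
  rw [ZMod.natCast_zmod_val, sub_add_cancel]

/-- The edge `{1, m}` of the polygon is a side of a triangle of the triangulation. -/
lemma IsTriangulation.exists_triangle (hm : 4 ≤ m) (hT : IsTriangulation m T) :
    ∃ k : ℕ, 1 < k ∧ k < m ∧ (k = 2 ∨ s((1 : ZMod m), (k : ZMod m)) ∈ T) ∧
      (k + 1 = m ∨ s((k : ZMod m), (m : ZMod m)) ∈ T) := by
  classical
  have hedge : s(((1 : ℕ) : ZMod m), (m : ZMod m)) ∉ T := fun h => by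
    simpa using isDiag_mk_iff.mp (hT.2.1 _ h)
  set A : Finset (ℕ × ℕ) := (Finset.Icc 1 m ×ˢ Finset.Icc 1 m).filter
    (fun p => p.1 < p.2 ∧ s((p.1 : ZMod m), (p.2 : ZMod m)) ∈ T) with hA
  have hmemA : ∀ a b, (a, b) ∈ A ↔
      ((1 ≤ a ∧ a ≤ m) ∧ 1 ≤ b ∧ b ≤ m) ∧ a < b ∧ s((a : ZMod m), (b : ZMod m)) ∈ T := by
    intro a b
    simp [hA]
  have hcardA : T.card ≤ A.card := by
    refine (Finset.card_le_card (t := A.image (fun p => s((p.1 : ZMod m), (p.2 : ZMod m)))) ?_).trans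
      Finset.card_image_le
    intro e he
    induction e using Sym2.ind with
    | _ x y =>
    obtain ⟨a, ha1, ham, rfl⟩ := exists_natCast_eq (by omega) x
    obtain ⟨b, hb1, hbm, rfl⟩ := exists_natCast_eq (by omega) y
    rw [Finset.mem_image]
    rcases lt_trichotomy a b with h | h | h
    · exact ⟨(a, b), (hmemA _ _).2 ⟨⟨⟨ha1, ham⟩, hb1, hbm⟩, h, he⟩, rfl⟩
    · subst h
      simpa using isDiag_mk_iff.mp (hT.2.1 _ he)
    · exact ⟨(b, a), (hmemA _ _).2 ⟨⟨⟨hb1, hbm⟩, ha1, ham⟩, h, by rwa [Sym2.eq_swap]⟩,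
        Sym2.eq_swap⟩
  have houter : (1, m) ∉ A := fun h => hedge ((hmemA _ _).1 h).2.2
  have hmem : ∀ a b, (a, b) ∈ insert (1, m) A → 1 ≤ a ∧ a + 2 ≤ b ∧ b ≤ m := by
    intro a b h
    rcases Finset.mem_insert.mp h with h | h
    · obtain ⟨rfl, rfl⟩ := Prod.mk.inj h
      omega
    · obtain ⟨h1, h2, h3⟩ := (hmemA _ _).1 h
      have : b ≠ a + 1 := by
        rintro rfl
        simpa using isDiag_mk_iff.mp (hT.2.1 _ h3)
      omega
  obtain ⟨k, hk1, hkm, h, h'⟩ := Poly.exists_triangle (S := insert (1, m) A) (l := 1) (r := m)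
    (Finset.mem_insert_self _ _) hmem
    (by
      intro a b c d h h' hac hcb hbd
      have h1 := hmem _ _ h
      have h2 := hmem _ _ h'
      simp only [Finset.mem_insert, Prod.mk.injEq] at h h'
      rcases h with h | h
      · omega
      rcases h' with h' | h'
      · omega
      exact hT.not_interleaved ((hmemA _ _).1 h).2.2 ((hmemA _ _).1 h').2.2 hac hcb hbd (by omega))
    (by
      rw [Finset.card_insert_of_notMem houter]
      have := hT.1
      omega)
  refine ⟨k, hk1, hkm, h.imp id fun h => ?_, h'.imp id fun h => ?_⟩ <;>
    rcases Finset.mem_insert.mp h with h | h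
  · have := (Prod.mk.inj h).2
    omega
  · simpa using ((hmemA _ _).1 h).2.2
  · have := (Prod.mk.inj h).1
    omega
  · exact ((hmemA _ _).1 h).2.2

end Labels

lemma IsPermissible.blue_of_mem {m : ℕ} {c : ZMod m → Bool} {T : Finset (Sym2 (ZMod m))}
    (hT : IsPermissible m c T) {v w : ZMod m} (hw : c w = false) (h : s(v, w) ∈ T) :
    c v = true := by
  obtain ⟨x, hx, hcx⟩ := hT.2 _ h
  rcases Sym2.mem_iff.mp hx with rfl | rfl
  · exact hcx
  · simp [hw] at hcx

/-- Let `P_m` (`m ≥ 4`) carry a non-trivial bicolouring, with its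
vertices labelled `1, 2, …, m` in cyclic order (vertex `i` is `(i : ZMod m)`, so vertex
`m` is `0`), vertex `1` blue and vertex `m` red.  Then every permissible triangulation
`T` satisfies exactly one of:
(i) `{1, m-1} ∈ T`;
(ii) `{2, m} ∈ T`, and then vertex `2` is blue;
(iii) there is `k` with `3 ≤ k ≤ m - 2` and `{1, k} ∈ T` and `{k, m} ∈ T`, and then
vertex `k` is blue; moreover such `k` is unique. -/
theorem trichotomy_at_blue_vertex (m : ℕ) (hm : 4 ≤ m) (c : ZMod m → Bool)
    (hc : IsNontrivialBicolouring m c)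
    (h1 : c (1 : ZMod m) = true) (hmred : c ((m : ℕ) : ZMod m) = false)
    (T : Finset (Sym2 (ZMod m))) (hT : IsPermissible m c T) :
    (s((1 : ZMod m), ((m - 1 : ℕ) : ZMod m)) ∈ T ∨
       s((2 : ZMod m), ((m : ℕ) : ZMod m)) ∈ T ∨ (∃ k : ℕ, Cond3 m T k)) ∧
    ¬(s((1 : ZMod m), ((m - 1 : ℕ) : ZMod m)) ∈ T ∧
        s((2 : ZMod m), ((m : ℕ) : ZMod m)) ∈ T) ∧
    ¬(s((1 : ZMod m), ((m - 1 : ℕ) : ZMod m)) ∈ T ∧ ∃ k : ℕ, Cond3 m T k) ∧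
    ¬(s((2 : ZMod m), ((m : ℕ) : ZMod m)) ∈ T ∧ ∃ k : ℕ, Cond3 m T k) ∧
    (s((2 : ZMod m), ((m : ℕ) : ZMod m)) ∈ T → c (2 : ZMod m) = true) ∧
    (∀ k : ℕ, Cond3 m T k → c ((k : ℕ) : ZMod m) = true) ∧
    (∀ k k' : ℕ, Cond3 m T k → Cond3 m T k' → k = k') := by
  have htri := hT.1
  have hno : ∀ {b c d : ℕ}, s((1 : ZMod m), (b : ZMod m)) ∈ T → s((c : ZMod m), (d : ZMod m)) ∈ T →
      1 < c → c < b → b < d → d ≤ m → False := by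
    intro b c d h h' h1 h2 h3 h4
    rw [← Nat.cast_one] at h
    exact htri.not_interleaved h h' h1 h2 h3 (by omega)
  refine ⟨?_, ?_, ?_, ?_, hT.blue_of_mem hmred, fun k hk => hT.blue_of_mem hmred hk.2.2.2, ?_⟩
  · obtain ⟨k, hk1, hkm, h, h'⟩ := htri.exists_triangle hm
    by_cases hk : k + 1 = m
    · left
      rw [show m - 1 = k by omega]
      exact h.resolve_left (by omega)
    · have h' := h'.resolve_left hk
      rcases h with rfl | h
      · exact Or.inr (Or.inl (by simpa using h'))
      · by_cases hk2 : k = 2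
        · subst hk2
          exact Or.inr (Or.inl (by simpa using h'))
        · exact Or.inr (Or.inr ⟨k, by omega, by omega, h, h'⟩)
  · rintro ⟨h, h'⟩
    exact hno (c := 2) h (by exact_mod_cast h') (by omega) (by omega) (by omega) le_rfl
  · rintro ⟨h, k, hk3, hk, -, h'⟩
    exact hno h h' (by omega) (by omega) (by omega) le_rfl
  · rintro ⟨h', k, hk3, hk, h, -⟩
    exact hno (c := 2) h (by exact_mod_cast h') (by omega) (by omega) (by omega) le_rfl
  · have key : ∀ k k' : ℕ, Cond3 m T k → Cond3 m T k' → ¬ k < k' := by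
      rintro k k' ⟨h1, h2, -, h⟩ ⟨h3, h4, h', -⟩ hlt
      exact hno h' h (by omega) hlt (by omega) le_rfl
    intro k k' h h'
    have := key _ _ h h'
    have := key _ _ h' h
    omega

end Poly
end
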